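/- Let d be an odd prime. The phase-space point operators transform covariantly under phase-space displacements: the phased Weyl operators satisfy W(b)† = W(−b), and for every b, m ∈ (ZMod d)², W(b) · A(m) · W(b)† = A(m + b). -/

import Mathlib

open Matrix

/-- The additive character `χ(c) = exp(2πi·c̃/d)`, where `c̃` is the canonical
integer representative of `c : ZMod d`. -/
noncomputable def chi (d : ℕ) (c : ZMod d) : ℂ :=
  Complex.exp (2 * Real.pi * Complex.I * (c.val : ℂ) / (d : ℂ))

/-- The shift matrix `S(q)`, with entries `S(q)_{x,y} = 1` if `x = y − q` and `0` otherwise. -/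
def shiftM (d : ℕ) (q : ZMod d) : Matrix (ZMod d) (ZMod d) ℂ :=
  Matrix.of fun x y => if x = y - q then 1 else 0

/-- The boost matrix `B(p)`, with entries `B(p)_{x,y} = χ(x·p)` if `x = y` and `0` otherwise. -/
noncomputable def boostM (d : ℕ) (p : ZMod d) : Matrix (ZMod d) (ZMod d) ℂ :=
  Matrix.of fun x y => if x = y then chi d (x * p) else 0

/-- The symplectic inner product `⟨a,a'⟩ = q·p' − p·q'` on `(ZMod d)²`. -/
def sympIP {d : ℕ} (a a' : ZMod d × ZMod d) : ZMod d :=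
  a.1 * a'.2 - a.2 * a'.1

/-- The phased Weyl operator `W(q,p) = χ(−2⁻¹·q·p) · S(q)·B(p)`,
where `2⁻¹` is the multiplicative inverse of `2` in `ZMod d`. -/
noncomputable def weylPh (d : ℕ) [NeZero d] (a : ZMod d × ZMod d) :
    Matrix (ZMod d) (ZMod d) ℂ :=
  chi d (-((2 : ZMod d)⁻¹ * a.1 * a.2)) • (shiftM d a.1 * boostM d a.2)

/-- The phase-space point operator `A(m) = (1/d) · Σ_{m'} χ(⟨m,m'⟩) · W(m')`. -/
noncomputable def pointOp (d : ℕ) [NeZero d] (m : ZMod d × ZMod d) :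
    Matrix (ZMod d) (ZMod d) ℂ :=
  (d : ℂ)⁻¹ • ∑ m' : ZMod d × ZMod d, chi d (sympIP m m') • weylPh d m'

/-- `chi d` is the standard additive character of `ZMod d`. -/
theorem chi_eq_stdAddChar (d : ℕ) [NeZero d] (c : ZMod d) : chi d c = ZMod.stdAddChar c := by
  rw [ZMod.stdAddChar_apply, ZMod.toCircle_apply, chi]

theorem chi_add (d : ℕ) [NeZero d] (a b : ZMod d) : chi d (a + b) = chi d a * chi d b := by
  simp only [chi_eq_stdAddChar, AddChar.map_add_eq_mul]

theorem star_chi (d : ℕ) [NeZero d] (a : ZMod d) : star (chi d a) = chi d (-a) := by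
  simp only [chi_eq_stdAddChar, AddChar.map_neg_eq_conj, starRingEnd_apply]

theorem weylPh_apply (d : ℕ) [NeZero d] (a : ZMod d × ZMod d) (x y : ZMod d) :
    weylPh d a x y =
      if x = y - a.1 then chi d (-((2 : ZMod d)⁻¹ * a.1 * a.2) + y * a.2) else 0 := by
  simp [weylPh, shiftM, boostM, Matrix.mul_apply, chi_add]

theorem two_mul_two_inv {d : ℕ} (hodd : Odd d) : (2 : ZMod d) * 2⁻¹ = 1 := by
  have h := ZMod.coe_mul_inv_eq_one (n := d) 2 (Nat.coprime_two_left.mpr hodd)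
  exact_mod_cast h

theorem weylPh_conjTranspose (d : ℕ) [NeZero d] (hodd : Odd d) (b : ZMod d × ZMod d) :
    (weylPh d b)ᴴ = weylPh d (-b) := by
  have h2 := two_mul_two_inv hodd
  ext x y
  rw [Matrix.conjTranspose_apply, weylPh_apply, weylPh_apply]
  by_cases h : y = x - b.1
  · subst h
    simp only [Prod.fst_neg, Prod.snd_neg, sub_neg_eq_add, sub_add_cancel, if_true, star_chi]
    congr 1
    linear_combination b.1 * b.2 * h2
  · have h' : ¬ x = y - (-b).1 := fun e => h (by rw [e, Prod.fst_neg]; ring)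
    rw [if_neg h, if_neg h', star_zero]

/-- The phased Weyl operators multiply up to half the symplectic inner product. -/
theorem weylPh_mul (d : ℕ) [NeZero d] (hodd : Odd d) (a b : ZMod d × ZMod d) :
    weylPh d a * weylPh d b = chi d (2⁻¹ * sympIP a b) • weylPh d (a + b) := by
  have h2 := two_mul_two_inv hodd
  ext x y
  simp only [Matrix.mul_apply, Matrix.smul_apply, weylPh_apply, smul_eq_mul, mul_ite, mul_zero,
    Finset.sum_ite_eq', Finset.mem_univ, if_true, ite_mul, zero_mul]
  by_cases h : x = y - b.1 - a.1
  · have h' : x = y - (a + b).1 := by rw [h, Prod.fst_add]; ring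
    rw [if_pos h, if_pos h', ← chi_add, ← chi_add]
    congr 1
    simp only [sympIP, Prod.fst_add, Prod.snd_add]
    linear_combination (b.1 * a.2) * h2
  · have h' : ¬ x = y - (a + b).1 := fun e => h (by rw [e, Prod.fst_add]; ring)
    rw [if_neg h, if_neg h']

theorem weylPh_conj_weylPh (d : ℕ) [NeZero d] (hodd : Odd d) (b m : ZMod d × ZMod d) :
    weylPh d b * weylPh d m * (weylPh d b)ᴴ = chi d (sympIP b m) • weylPh d m := by
  have h2 := two_mul_two_inv hodd
  rw [weylPh_conjTranspose d hodd, weylPh_mul d hodd, Matrix.smul_mul, weylPh_mul d hodd,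
    smul_smul, ← chi_add, show b + m + -b = m by abel]
  congr 2
  simp only [sympIP, Prod.fst_add, Prod.snd_add, Prod.fst_neg, Prod.snd_neg]
  linear_combination (b.1 * m.2 - b.2 * m.1) * h2

theorem stmt_19 (d : ℕ) [NeZero d] (hp : d.Prime) (hodd : Odd d) :
    -- the phased Weyl operators satisfy `W(b)† = W(−b)`
    (∀ b : ZMod d × ZMod d, (weylPh d b)ᴴ = weylPh d (-b)) ∧
    -- covariance of the point operators under phase-space displacements
    (∀ b m : ZMod d × ZMod d,
      weylPh d b * pointOp d m * (weylPh d b)ᴴ = pointOp d (m + b)) := by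
  refine ⟨weylPh_conjTranspose d hodd, fun b m => ?_⟩
  simp only [pointOp, Matrix.mul_smul, Matrix.smul_mul, Matrix.mul_sum, Matrix.sum_mul,
    weylPh_conj_weylPh d hodd, smul_smul, ← chi_add]
  congr 1
  refine Finset.sum_congr rfl fun m' _ => ?_
  congr 2
  simp only [sympIP, Prod.fst_add, Prod.snd_add]
  ring
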